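/- For n ≥ 1 and 0 ≤ k ≤ n-1, Σ_{σ ∈ S_n, des(σ)=k} q^{maj(σ)} = q^{nk - C(n,2)} T_k(B(n); q), where B(n) is the staircase Ferrers board consisting of all squares (i,j) with 1 ≤ i < j ≤ n. -/

import Mathlib

open Finset
open scoped Classical

noncomputable section

variable {R : Type*} [CommRing R]

/-- The q-integer `[m]_q = 1 + q + ... + q^{m-1}`. -/
def qint (q : R) (m : ℕ) : R := ∑ i ∈ Finset.range m, q ^ i

/-- The q-factorial `[m]_q!`. -/
def qfact (q : R) (m : ℕ) : R := ∏ i ∈ Finset.range m, qint q (i + 1)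

/-- A Ferrers board inside the `n × n` grid, given by column heights `c`:
square `(i,j)` (0-based row `i`, column `j`) belongs to the board iff `i < c j`. -/
def IsFerrers (n : ℕ) (c : Fin n → ℕ) : Prop := Monotone c ∧ ∀ j, c j ≤ n

/-- The squares of the Ferrers board with column heights `c`. -/
def boardSq (n : ℕ) (c : Fin n → ℕ) : Finset (Fin n × Fin n) :=
  Finset.univ.filter fun s => (s.1 : ℕ) < c s.2

/-- A set of rooks is non-attacking when no two share a row or a column. -/
def NonAttacking {n : ℕ} (C : Finset (Fin n × Fin n)) : Prop :=
  ∀ r ∈ C, ∀ r' ∈ C, r ≠ r' → r.1 ≠ r'.1 ∧ r.2 ≠ r'.2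

/-- Placements of `k` non-attacking rooks on the Ferrers board. -/
def placements (n : ℕ) (c : Fin n → ℕ) (k : ℕ) : Finset (Finset (Fin n × Fin n)) :=
  Finset.univ.filter fun C => C.card = k ∧ C ⊆ boardSq n c ∧ NonAttacking C

/-- `inv(C,B)`: the number of squares of the board that do not contain a rook and
are not above (smaller row index, same column) nor to the right of (same row,
larger column index) any rook of `C`. -/
def rookInv (n : ℕ) (c : Fin n → ℕ) (C : Finset (Fin n × Fin n)) : ℕ :=
  ((boardSq n c).filter fun s => s ∉ C ∧ ∀ r ∈ C,
    ¬(r.2 = s.2 ∧ s.1 < r.1) ∧ ¬(r.1 = s.1 ∧ r.2 < s.2)).card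

/-- The Garsia–Remmel q-rook polynomial `R_k(B;q)`. -/
def qRook (q : R) (n : ℕ) (c : Fin n → ℕ) (k : ℕ) : R :=
  ∑ C ∈ placements n c k, q ^ rookInv n c C

/-- The polynomial (in `x`) `∑_{j=0}^n [j]_q! R_{n-j}(B;q) ∏_{i=j+1}^n (x - q^i)`. -/
def hitGen (q : R) (n : ℕ) (c : Fin n → ℕ) : Polynomial R :=
  ∑ j ∈ Finset.range (n + 1),
    Polynomial.C (qfact q j * qRook q n c (n - j)) *
      ∏ i ∈ Finset.Icc (j + 1) n, (Polynomial.X - Polynomial.C (q ^ i))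

/-- The Garsia–Remmel q-hit polynomial `T_k(B;q)`, defined by
`∑_{j=0}^n [j]_q! R_{n-j}(B;q) ∏_{i=j+1}^n (x - q^i) = ∑_k T_k(B;q) x^k`. -/
def qHit (q : R) (n : ℕ) (c : Fin n → ℕ) (k : ℕ) : R := (hitGen q n c).coeff k

/-- Placements of `n` non-attacking rooks on the full `n × n` grid with exactly
`k` rooks on the board. -/
def fullPlacements (n : ℕ) (c : Fin n → ℕ) (k : ℕ) : Finset (Finset (Fin n × Fin n)) :=
  Finset.univ.filter fun C => C.card = n ∧ NonAttacking C ∧ (C ∩ boardSq n c).card = k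

end

noncomputable section

/-- The descent set of a permutation of `Fin n` (0-based positions). -/
def descSet {n : ℕ} (σ : Equiv.Perm (Fin n)) : Finset (Fin n) :=
  Finset.univ.filter fun i => ∃ h : (i : ℕ) + 1 < n, σ ⟨(i : ℕ) + 1, h⟩ < σ i

/-- The number of descents. -/
def desStat {n : ℕ} (σ : Equiv.Perm (Fin n)) : ℕ := (descSet σ).card

/-- The major index (descent positions counted 1-based). -/
def majStat {n : ℕ} (σ : Equiv.Perm (Fin n)) : ℕ := ∑ i ∈ descSet σ, ((i : ℕ) + 1)

end

section Rank

variable {R : Type*} [CommRing R]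

theorem qint_succ (q : R) (m : ℕ) : qint q (m + 1) = qint q m + q ^ m :=
  Finset.sum_range_succ _ _

theorem qint_succ' (q : R) (m : ℕ) : qint q (m + 1) = 1 + q * qint q m := by
  simp only [qint, Finset.sum_range_succ', Finset.mul_sum, pow_succ', pow_zero]
  ring

theorem sub_one_mul_qint (q : R) (m : ℕ) : (q - 1) * qint q m = q ^ m - 1 :=
  mul_geom_sum q m

theorem qfact_succ (q : R) (m : ℕ) : qfact q (m + 1) = qfact q m * qint q (m + 1) :=
  Finset.prod_range_succ _ _

theorem sum_pow_card_gt {α : Type*} [LinearOrder α] (q : R) (S : Finset α) :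
    ∑ i ∈ S, q ^ (S.filter (fun j => i < j)).card = qint q S.card := by
  induction S using Finset.induction_on_min with
  | empty => simp [qint]
  | insert a s h ih =>
    have ha : a ∉ s := fun H => lt_irrefl _ (h a H)
    rw [Finset.sum_insert ha, Finset.card_insert_of_notMem ha, qint_succ, ← ih, add_comm]
    congr 1
    · refine Finset.sum_congr rfl fun i hi => ?_
      rw [Finset.filter_insert, if_neg (not_lt.2 (h i hi).le)]
    · rw [Finset.filter_insert, if_neg (lt_irrefl _), Finset.filter_true_of_mem h]

theorem sum_pow_card_lt {α : Type*} [LinearOrder α] (q : R) (S : Finset α) :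
    ∑ i ∈ S, q ^ (S.filter (fun j => j < i)).card = qint q S.card :=
  sum_pow_card_gt (α := αᵒᵈ) q S

end Rank

section Rook

variable {n : ℕ}

/-- The upper-left corner of the `(n+1) × (n+1)` grid. -/
def cornerEmb (n : ℕ) : Fin n × Fin n ↪ Fin (n + 1) × Fin (n + 1) :=
  Fin.castSuccEmb.prodMap Fin.castSuccEmb

@[simp] theorem cornerEmb_apply (s : Fin n × Fin n) :
    cornerEmb n s = (s.1.castSucc, s.2.castSucc) := rfl

/-- The part of a placement lying in the upper-left corner. -/
def cornerPart (C : Finset (Fin (n + 1) × Fin (n + 1))) : Finset (Fin n × Fin n) :=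
  Finset.univ.filter fun s => (s.1.castSucc, s.2.castSucc) ∈ C

/-- The rows containing no rook. -/
def freeRows (D : Finset (Fin n × Fin n)) : Finset (Fin n) :=
  Finset.univ.filter fun i => ∀ r ∈ D, r.1 ≠ i

theorem mem_freeRows {D : Finset (Fin n × Fin n)} {i : Fin n} :
    i ∈ freeRows D ↔ ∀ r ∈ D, r.1 ≠ i := by simp [freeRows]

theorem card_freeRows_add {D : Finset (Fin n × Fin n)} (hD : NonAttacking D) :
    (freeRows D).card + D.card = n := by
  have h1 : D.card = (D.image Prod.fst).card := by
    refine (Finset.card_image_of_injOn fun r hr s hs h => ?_).symm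
    by_contra hne
    exact (hD r hr s hs hne).1 h
  have h2 : freeRows D = (D.image Prod.fst)ᶜ := by
    ext i
    rw [mem_freeRows]
    simp only [Finset.mem_compl, Finset.mem_image, not_exists, not_and, ne_eq]
  rw [h2, h1, Finset.card_compl_add_card, Fintype.card_fin]

theorem mem_placements {c : Fin n → ℕ} {k : ℕ} {C : Finset (Fin n × Fin n)} :
    C ∈ placements n c k ↔ C.card = k ∧ C ⊆ boardSq n c ∧ NonAttacking C := by
  simp [placements]

theorem mem_boardSq {c : Fin n → ℕ} {s : Fin n × Fin n} :
    s ∈ boardSq n c ↔ (s.1 : ℕ) < c s.2 := by simp [boardSq]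

theorem mem_map_cornerEmb {D : Finset (Fin n × Fin n)} {a b : Fin (n + 1)} :
    (a, b) ∈ D.map (cornerEmb n) ↔
      ∃ a' b', (a', b') ∈ D ∧ a'.castSucc = a ∧ b'.castSucc = b := by
  simp

theorem corner_notMem (D : Finset (Fin n × Fin n)) (a : Fin (n + 1)) :
    (a, Fin.last n) ∉ D.map (cornerEmb n) := by
  rw [mem_map_cornerEmb]
  rintro ⟨a', b', -, -, h⟩
  exact (Fin.castSucc_lt_last b').ne h

theorem card_filter_boardSq_succ (P : Fin (n + 1) × Fin (n + 1) → Prop)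
    [DecidablePred P] :
    ((boardSq (n + 1) fun j => (j : ℕ)).filter P).card =
      ((boardSq n fun j => (j : ℕ)).filter fun s => P (cornerEmb n s)).card +
        (Finset.univ.filter fun i : Fin n => P (i.castSucc, Fin.last n)).card := by
  have h (x : Fin n) : ¬ n < (x : ℕ) := x.2.not_gt
  simp only [boardSq, Finset.filter_filter, Finset.card_filter,
    Fintype.sum_prod_type_right, Fin.sum_univ_castSucc]
  simp [h]

theorem rookInv_map_cornerEmb (D : Finset (Fin n × Fin n)) :
    rookInv (n + 1) (fun j => (j : ℕ)) (D.map (cornerEmb n)) =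
      rookInv n (fun j => (j : ℕ)) D + (freeRows D).card := by
  rw [rookInv, card_filter_boardSq_succ, rookInv, freeRows]
  congr 2
  · refine Finset.filter_congr fun s _ => ?_
    rw [Finset.mem_map', Finset.forall_mem_map]
    simp only [cornerEmb_apply, Fin.castSucc_inj, Fin.castSucc_lt_castSucc_iff]
  · refine Finset.filter_congr fun i _ => ?_
    simp only [corner_notMem, Finset.forall_mem_map, cornerEmb_apply, Fin.castSucc_inj,
      Fin.castSucc_lt_last, (Fin.castSucc_lt_last _).ne, not_false_eq_true, true_and,
      false_and, and_true, ne_eq]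

theorem rookInv_insert_map_cornerEmb (D : Finset (Fin n × Fin n)) (i : Fin n) :
    rookInv (n + 1) (fun j => (j : ℕ))
        (insert (i.castSucc, Fin.last n) (D.map (cornerEmb n))) =
      rookInv n (fun j => (j : ℕ)) D + ((freeRows D).filter (fun j => i < j)).card := by
  rw [rookInv, card_filter_boardSq_succ, rookInv, freeRows, Finset.filter_filter]
  congr 2
  · refine Finset.filter_congr fun s _ => ?_
    rw [Finset.mem_insert, Finset.mem_map', Finset.forall_mem_insert, Finset.forall_mem_map]
    have h : ¬ Fin.last n < s.2.castSucc := (Fin.castSucc_lt_last _).not_gt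
    simp only [cornerEmb_apply, Fin.castSucc_inj, Fin.castSucc_lt_castSucc_iff, Prod.mk.injEq,
      (Fin.castSucc_lt_last _).ne, (Fin.castSucc_lt_last _).ne', h, and_false, false_and,
      false_or, not_false_eq_true, true_and]
  · refine Finset.filter_congr fun j _ => ?_
    rw [Finset.mem_insert, Finset.forall_mem_insert, Finset.forall_mem_map]
    simp only [corner_notMem, cornerEmb_apply, Fin.castSucc_inj, Prod.mk.injEq,
      Fin.castSucc_lt_castSucc_iff,
      Fin.castSucc_lt_last, (Fin.castSucc_lt_last _).ne, not_false_eq_true, true_and,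
      false_and, and_true, ne_eq, or_false, lt_irrefl, and_false]
    constructor
    · rintro ⟨h1, h2, h3⟩
      exact ⟨h3, lt_of_le_of_ne (not_lt.1 h2) (Ne.symm h1)⟩
    · rintro ⟨h1, h2⟩
      exact ⟨h2.ne', h2.not_gt, h1⟩

theorem filter_map_cornerPart {C : Finset (Fin (n + 1) × Fin (n + 1))}
    (hC : C ⊆ boardSq (n + 1) fun j => (j : ℕ)) :
    (cornerPart C).map (cornerEmb n) = C.filter fun s => s.2 ≠ Fin.last n := by
  ext ⟨a, b⟩
  rw [mem_map_cornerEmb, Finset.mem_filter]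
  constructor
  · rintro ⟨a', b', h, rfl, rfl⟩
    exact ⟨by simpa [cornerPart] using h, (Fin.castSucc_lt_last b').ne⟩
  · rintro ⟨h, hb⟩
    have h1 := mem_boardSq.1 (hC h)
    have h2 : a ≠ Fin.last n := by
      rintro rfl
      have := b.2
      simp at h1
      omega
    obtain ⟨a', rfl⟩ := Fin.exists_castSucc_eq.2 h2
    obtain ⟨b', rfl⟩ := Fin.exists_castSucc_eq.2 hb
    exact ⟨a', b', by simpa [cornerPart] using h, rfl, rfl⟩

theorem nonAttacking_map_cornerEmb {D : Finset (Fin n × Fin n)} :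
    NonAttacking (D.map (cornerEmb n)) ↔ NonAttacking D := by
  simp only [NonAttacking, Finset.forall_mem_map, cornerEmb_apply, ne_eq,
    Fin.castSucc_inj, Prod.ext_iff]

theorem map_cornerEmb_subset {D : Finset (Fin n × Fin n)} :
    D.map (cornerEmb n) ⊆ boardSq (n + 1) (fun j => (j : ℕ)) ↔
      D ⊆ boardSq n (fun j => (j : ℕ)) := by
  simp only [Finset.subset_iff, Finset.forall_mem_map, mem_boardSq, cornerEmb_apply,
    Fin.val_castSucc]

theorem cornerPart_map (D : Finset (Fin n × Fin n)) :
    cornerPart (D.map (cornerEmb n)) = D := by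
  ext s
  rw [cornerPart, Finset.mem_filter, ← cornerEmb_apply, Finset.mem_map']
  simp

theorem cornerPart_insert (C : Finset (Fin (n + 1) × Fin (n + 1))) (a : Fin (n + 1)) :
    cornerPart (insert (a, Fin.last n) C) = cornerPart C := by
  simp [cornerPart, (Fin.castSucc_lt_last _).ne]

theorem nonAttacking_mono {C D : Finset (Fin n × Fin n)} (hC : NonAttacking C) (h : D ⊆ C) :
    NonAttacking D := fun r hr s hs => hC r (h hr) s (h hs)

theorem nonAttacking_insert {D : Finset (Fin n × Fin n)} {i : Fin n} :
    NonAttacking (insert (i.castSucc, Fin.last n) (D.map (cornerEmb n))) ↔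
      NonAttacking D ∧ i ∈ freeRows D := by
  constructor
  · intro h
    refine ⟨nonAttacking_map_cornerEmb.1 (nonAttacking_mono h (Finset.subset_insert _ _)),
      mem_freeRows.2 fun r hr hri => ?_⟩
    have hmem := Finset.mem_map_of_mem (cornerEmb n) hr
    refine (h _ (Finset.mem_insert_of_mem hmem) _ (Finset.mem_insert_self _ _) ?_).1 ?_
    · intro h0
      rw [h0] at hmem
      exact corner_notMem _ _ hmem
    · rw [cornerEmb_apply, hri]
  · rintro ⟨h, hi⟩
    rw [mem_freeRows] at hi
    have h' := nonAttacking_map_cornerEmb.2 h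
    have key (r) (hr : r ∈ D.map (cornerEmb n)) :
        r.1 ≠ i.castSucc ∧ r.2 ≠ Fin.last n := by
      obtain ⟨s, hs, rfl⟩ := Finset.mem_map.1 hr
      exact ⟨fun H => hi s hs (Fin.castSucc_inj.1 H), (Fin.castSucc_lt_last _).ne⟩
    intro r hr s hs hrs
    rcases Finset.mem_insert.1 hr with rfl | hr
    · rcases Finset.mem_insert.1 hs with rfl | hs
      · exact absurd rfl hrs
      · exact ⟨(key s hs).1.symm, (key s hs).2.symm⟩
    · rcases Finset.mem_insert.1 hs with rfl | hs
      · exact key r hr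
      · exact h' r hr s hs hrs

variable {R : Type*} [CommRing R]

theorem placements_eq_empty {c : Fin n → ℕ} {k : ℕ} (hk : n < k) : placements n c k = ∅ := by
  refine Finset.eq_empty_of_forall_notMem fun C hC => ?_
  obtain ⟨h1, -, h3⟩ := mem_placements.1 hC
  have := card_freeRows_add h3
  omega

theorem qRook_eq_zero (q : R) {c : Fin n → ℕ} {k : ℕ} (hk : n < k) : qRook q n c k = 0 := by
  rw [qRook, placements_eq_empty hk, Finset.sum_empty]

theorem sum_placements_avoiding (q : R) (n k : ℕ) :
    ∑ C ∈ (placements (n + 1) (fun j => (j : ℕ)) k).filter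
        (fun C => ∀ s ∈ C, s.2 ≠ Fin.last n), q ^ rookInv (n + 1) (fun j => (j : ℕ)) C =
      q ^ (n - k) * qRook q n (fun j => (j : ℕ)) k := by
  rw [qRook, Finset.mul_sum]
  symm
  refine Finset.sum_bij (fun D _ => D.map (cornerEmb n)) ?_ ?_ ?_ ?_
  · intro D hD
    obtain ⟨h1, h2, h3⟩ := mem_placements.1 hD
    refine Finset.mem_filter.2 ⟨mem_placements.2 ⟨by rw [Finset.card_map, h1],
      map_cornerEmb_subset.2 h2, nonAttacking_map_cornerEmb.2 h3⟩, ?_⟩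
    rintro ⟨a, b⟩ hs rfl
    exact corner_notMem _ _ hs
  · intro D _ D' _ h
    exact Finset.map_injective _ h
  · intro C hC
    obtain ⟨hC, hl⟩ := Finset.mem_filter.1 hC
    obtain ⟨h1, h2, h3⟩ := mem_placements.1 hC
    have h := filter_map_cornerPart h2
    rw [Finset.filter_true_of_mem hl] at h
    refine ⟨cornerPart C, ?_, h⟩
    rw [mem_placements, ← map_cornerEmb_subset, ← nonAttacking_map_cornerEmb,
      ← Finset.card_map (cornerEmb n), h]
    exact ⟨h1, h2, h3⟩
  · intro D hD
    obtain ⟨h1, -, h3⟩ := mem_placements.1 hD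
    have := card_freeRows_add h3
    rw [rookInv_map_cornerEmb, pow_add, mul_comm]
    congr 2
    omega

theorem sum_placements_meeting (q : R) (n k : ℕ) :
    ∑ C ∈ (placements (n + 1) (fun j => (j : ℕ)) (k + 1)).filter
        (fun C => ¬ ∀ s ∈ C, s.2 ≠ Fin.last n), q ^ rookInv (n + 1) (fun j => (j : ℕ)) C =
      qint q (n - k) * qRook q n (fun j => (j : ℕ)) k := by
  have h0 : qint q (n - k) * qRook q n (fun j => (j : ℕ)) k =
      ∑ D ∈ placements n (fun j => (j : ℕ)) k, ∑ i ∈ freeRows D,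
        q ^ (rookInv n (fun j => (j : ℕ)) D + ((freeRows D).filter (fun j => i < j)).card) := by
    rw [qRook, Finset.mul_sum]
    refine Finset.sum_congr rfl fun D hD => ?_
    obtain ⟨h1, -, h3⟩ := mem_placements.1 hD
    have := card_freeRows_add h3
    simp only [pow_add]
    rw [← Finset.mul_sum, sum_pow_card_gt, mul_comm]
    congr 2
    omega
  rw [h0, Finset.sum_sigma']
  symm
  refine Finset.sum_bij
    (fun x _ => insert (x.2.castSucc, Fin.last n) (x.1.map (cornerEmb n))) ?_ ?_ ?_ ?_
  · rintro ⟨D, i⟩ hx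
    obtain ⟨hD, hi⟩ := Finset.mem_sigma.1 hx
    obtain ⟨h1, h2, h3⟩ := mem_placements.1 hD
    refine Finset.mem_filter.2 ⟨mem_placements.2 ⟨?_, ?_, nonAttacking_insert.2 ⟨h3, hi⟩⟩, ?_⟩
    · rw [Finset.card_insert_of_notMem (corner_notMem _ _), Finset.card_map, h1]
    · refine Finset.insert_subset (mem_boardSq.2 ?_) (map_cornerEmb_subset.2 h2)
      simp
    · intro H
      exact H _ (Finset.mem_insert_self _ _) rfl
  · rintro ⟨D, i⟩ - ⟨D', i'⟩ - h
    dsimp only at h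
    have hD : D = D' := by
      have := congrArg cornerPart h
      simpa only [cornerPart_insert, cornerPart_map] using this
    subst hD
    have hi := Finset.mem_insert_self (i.castSucc, Fin.last n) (D.map (cornerEmb n))
    rw [h, Finset.mem_insert, or_iff_left (corner_notMem _ _), Prod.mk.injEq,
      Fin.castSucc_inj] at hi
    rw [hi.1]
  · intro C hC
    obtain ⟨hC, hl⟩ := Finset.mem_filter.1 hC
    obtain ⟨h1, h2, h3⟩ := mem_placements.1 hC
    push Not at hl
    obtain ⟨⟨a, b⟩, hs, hb⟩ := hl
    dsimp only at hb
    subst hb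
    have ha : a ≠ Fin.last n := by
      rintro rfl
      simpa using mem_boardSq.1 (h2 hs)
    obtain ⟨i, rfl⟩ := Fin.exists_castSucc_eq.2 ha
    have h := filter_map_cornerPart h2
    have heq : insert (i.castSucc, Fin.last n) ((cornerPart C).map (cornerEmb n)) = C := by
      ext s
      rw [h, Finset.mem_insert, Finset.mem_filter]
      constructor
      · rintro (rfl | h)
        exacts [hs, h.1]
      · intro hsC
        by_cases hl : s.2 = Fin.last n
        · left
          by_contra hne
          exact (h3 _ hsC _ hs hne).2 hl
        · exact Or.inr ⟨hsC, hl⟩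
    have hcard := h1
    rw [← heq, Finset.card_insert_of_notMem (corner_notMem _ _), Finset.card_map] at hcard
    rw [← heq, nonAttacking_insert] at h3
    refine ⟨⟨cornerPart C, i⟩, Finset.mem_sigma.2
      ⟨mem_placements.2 ⟨Nat.succ_injective hcard, ?_, h3.1⟩, h3.2⟩, heq⟩
    rw [← map_cornerEmb_subset, h]
    exact (Finset.filter_subset _ _).trans h2
  · rintro ⟨D, i⟩ -
    rw [rookInv_insert_map_cornerEmb]

theorem qRook_succ_zero (q : R) (n : ℕ) :
    qRook q (n + 1) (fun j => (j : ℕ)) 0 = q ^ n * qRook q n (fun j => (j : ℕ)) 0 := by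
  have h := sum_placements_avoiding q n 0
  rw [Nat.sub_zero] at h
  rw [← h, qRook, Finset.filter_true_of_mem]
  intro C hC s hs
  rw [mem_placements, Finset.card_eq_zero] at hC
  simp [hC.1] at hs

theorem qRook_succ_succ (q : R) (n k : ℕ) :
    qRook q (n + 1) (fun j => (j : ℕ)) (k + 1) =
      q ^ (n - (k + 1)) * qRook q n (fun j => (j : ℕ)) (k + 1) +
        qint q (n - k) * qRook q n (fun j => (j : ℕ)) k := by
  rw [← sum_placements_avoiding, ← sum_placements_meeting, qRook,
    Finset.sum_filter_add_sum_filter_not]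

end Rook

section HitPolynomial

open Polynomial

/-- The product `(x - q^(j+1)) ⋯ (x - q^n)`. -/
noncomputable def hitProd {R : Type*} [CommRing R] (q : R) (j n : ℕ) : R[X] :=
  ∏ i ∈ Finset.Icc (j + 1) n, (X - C (q ^ i))

theorem hitProd_succ_right {R : Type*} [CommRing R] (q : R) {j n : ℕ} (h : j ≤ n) :
    hitProd q j (n + 1) = hitProd q j n * (X - C (q ^ (n + 1))) := by
  rw [hitProd, Finset.prod_Icc_succ_top (by omega), hitProd]

theorem hitProd_succ_left {R : Type*} [CommRing R] (q : R) {j n : ℕ} (h : j < n) :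
    hitProd q j n = (X - C (q ^ (j + 1))) * hitProd q (j + 1) n := by
  rw [hitProd, ← Finset.mul_prod_Ioc_eq_prod_Icc (by omega), hitProd,
    Finset.Icc_add_one_left_eq_Ioc]

theorem hitProd_comp {K : Type*} [Field K] {q : K} (hq : q ≠ 0) {j n : ℕ} (h : j ≤ n) :
    C (q ^ n) * (hitProd q j n).comp (C q⁻¹ * X) = C (q ^ j) * hitProd q (j + 1) (n + 1) := by
  induction n, h using Nat.le_induction with
  | base => simp [hitProd]
  | succ n h ih =>
    rw [hitProd_succ_right q h, hitProd_succ_right q (Nat.succ_le_succ h), ← mul_assoc, ← ih,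
      mul_comp, sub_comp, X_comp, C_comp]
    have h1 : (X : K[X]) - C (q ^ (n + 1 + 1)) = C q * (C q⁻¹ * X - C (q ^ (n + 1))) := by
      rw [mul_sub, ← mul_assoc, ← C_mul, ← C_mul, mul_inv_cancel₀ hq, C_1, one_mul, pow_succ']
    rw [h1, pow_succ q n, C_mul]
    ring

/-- The coefficient of `(x - q^(j+1)) ⋯ (x - q^n)` in the hit polynomial of the staircase. -/
noncomputable def stairCoeff {R : Type*} [CommRing R] (q : R) (n j : ℕ) : R :=
  if j ≤ n then qfact q j * qRook q n (fun i => (i : ℕ)) (n - j) else 0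

theorem hitGen_eq {R : Type*} [CommRing R] (q : R) (n : ℕ) :
    hitGen q n (fun i => (i : ℕ)) =
      ∑ j ∈ Finset.range (n + 1), C (stairCoeff q n j) * hitProd q j n := by
  refine Finset.sum_congr rfl fun j hj => ?_
  rw [stairCoeff, if_pos (Nat.lt_succ_iff.1 (Finset.mem_range.1 hj)), hitProd]

theorem stairCoeff_succ_zero {R : Type*} [CommRing R] (q : R) (n : ℕ) :
    stairCoeff q (n + 1) 0 = 0 := by
  rw [stairCoeff, if_pos (Nat.zero_le _), Nat.sub_zero, qRook_succ_succ,
    qRook_eq_zero q (Nat.lt_succ_self n), Nat.sub_self]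
  simp [qint]

theorem stairCoeff_succ_succ {R : Type*} [CommRing R] (q : R) {n j : ℕ} (hj : j ≤ n) :
    stairCoeff q (n + 1) (j + 1) =
      qint q (j + 1) * (q ^ j * stairCoeff q n j + stairCoeff q n (j + 1)) := by
  rw [stairCoeff, if_pos (by omega), stairCoeff, if_pos hj, stairCoeff, qfact_succ,
    Nat.add_sub_add_right]
  rcases hj.lt_or_eq with h | rfl
  · obtain ⟨m, rfl⟩ : ∃ m, n = j + 1 + m := ⟨n - (j + 1), by omega⟩
    rw [if_pos (by omega), show j + 1 + m - j = m + 1 by omega, qRook_succ_succ,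
      show j + 1 + m - (m + 1) = j by omega, show j + 1 + m - m = j + 1 by omega,
      show j + 1 + m - (j + 1) = m by omega]
    ring
  · rw [if_neg (by omega), Nat.sub_self, qRook_succ_zero]
    ring

theorem hitGen_succ {K : Type*} [Field K] {q : K} (hq : q ≠ 0) (n : ℕ) :
    C (q - 1) * hitGen q (n + 1) (fun i => (i : ℕ)) =
      (C (q ^ (n + 1)) - X) * hitGen q n (fun i => (i : ℕ)) +
        (X - 1) * (C (q ^ n) * (hitGen q n (fun i => (i : ℕ))).comp (C q⁻¹ * X)) := by
  have h1 : hitGen q (n + 1) (fun i => (i : ℕ)) = ∑ j ∈ Finset.range (n + 1),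
      C (stairCoeff q n j) * (C (q ^ j * qint q (j + 1)) * hitProd q (j + 1) (n + 1) +
        C (qint q j) * hitProd q j (n + 1)) := by
    have h2 : ∑ j ∈ Finset.range (n + 1),
        C (stairCoeff q n j) * (C (qint q j) * hitProd q j (n + 1)) =
        ∑ j ∈ Finset.range (n + 1),
        C (stairCoeff q n (j + 1)) * (C (qint q (j + 1)) * hitProd q (j + 1) (n + 1)) := by
      have h3 := Finset.sum_range_succ
        (fun j => C (stairCoeff q n j) * (C (qint q j) * hitProd q j (n + 1))) (n + 1)
      rw [Finset.sum_range_succ'] at h3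
      simpa [stairCoeff, qint] using h3.symm
    simp only [mul_add, Finset.sum_add_distrib]
    rw [h2, hitGen_eq, Finset.sum_range_succ', stairCoeff_succ_zero, C_0, zero_mul, add_zero,
      ← Finset.sum_add_distrib]
    refine Finset.sum_congr rfl fun j hj => ?_
    rw [stairCoeff_succ_succ q (Nat.lt_succ_iff.1 (Finset.mem_range.1 hj))]
    simp only [C_mul, C_add]
    ring
  rw [h1, hitGen_eq, Polynomial.sum_comp]
  simp only [Finset.mul_sum]
  rw [← Finset.sum_add_distrib]
  refine Finset.sum_congr rfl fun j hj => ?_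
  have hj : j ≤ n := Nat.lt_succ_iff.1 (Finset.mem_range.1 hj)
  have hc := hitProd_comp hq hj
  have hr := hitProd_succ_right q hj
  rw [hitProd_succ_left q (Nat.lt_succ_of_le hj)] at hr
  rw [hitProd_succ_left q (Nat.lt_succ_of_le hj), mul_comp, C_comp]
  have e1 : C (q - 1) * C (qint q j) = (C (q ^ j) - 1 : K[X]) := by
    rw [← C_mul, sub_one_mul_qint, C_sub, C_1]
  have e2 : C (q - 1) * C (qint q (j + 1)) = (C (q ^ (j + 1)) - 1 : K[X]) := by
    rw [← C_mul, sub_one_mul_qint, C_sub, C_1]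
  rw [C_mul (a := q ^ j)]
  linear_combination C (stairCoeff q n j) * (C (q ^ j) * hitProd q (j + 1) (n + 1) * e2 +
    (X - C (q ^ (j + 1))) * hitProd q (j + 1) (n + 1) * e1 - (X - 1) * hc - hr)

theorem qHit_zero (k : ℕ) {R : Type*} [CommRing R] (q : R) :
    qHit q 0 (fun i => (i : ℕ)) k = if k = 0 then 1 else 0 := by
  have : qRook q 0 (fun i => (i : ℕ)) 0 = 1 := by
    have h : placements 0 (fun i => (i : ℕ)) 0 = {∅} := by
      ext C
      rw [mem_placements, Finset.card_eq_zero, Finset.mem_singleton]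
      refine ⟨fun h => h.1, ?_⟩
      rintro rfl
      simp [NonAttacking]
    simp [qRook, h, rookInv, boardSq]
  simp [qHit, hitGen, qfact, this, coeff_one]

theorem qHit_succ_zero {K : Type*} [Field K] {q : K} (hq : q ≠ 0) (n : ℕ) :
    (q - 1) * qHit q (n + 1) (fun i => (i : ℕ)) 0 =
      (q ^ (n + 1) - q ^ n) * qHit q n (fun i => (i : ℕ)) 0 := by
  have h := congrArg (fun p => coeff p 0) (hitGen_succ hq n)
  simp only [sub_mul, one_mul, coeff_add, coeff_sub, coeff_C_mul, coeff_X_mul_zero,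
    comp_C_mul_X_coeff, pow_zero, mul_one] at h
  simp only [qHit]
  rw [sub_mul, one_mul, h]
  ring

theorem qHit_succ_succ {K : Type*} [Field K] {q : K} (hq : q ≠ 0) (n k : ℕ) :
    (q - 1) * qHit q (n + 1) (fun i => (i : ℕ)) (k + 1) =
      (q ^ (n + 1) - q ^ n * q⁻¹ ^ (k + 1)) * qHit q n (fun i => (i : ℕ)) (k + 1) +
        (q ^ n * q⁻¹ ^ k - 1) * qHit q n (fun i => (i : ℕ)) k := by
  have h := congrArg (fun p => coeff p (k + 1)) (hitGen_succ hq n)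
  simp only [sub_mul, one_mul, coeff_add, coeff_sub, coeff_C_mul, coeff_X_mul,
    comp_C_mul_X_coeff] at h
  simp only [qHit]
  rw [sub_mul, one_mul, h]
  ring

theorem map_qHit {R S : Type*} [CommRing R] [CommRing S] (φ : R →+* S) (q : R) (n : ℕ)
    (c : Fin n → ℕ) (k : ℕ) : φ (qHit q n c k) = qHit (φ q) n c k := by
  rw [qHit, ← coeff_map, qHit]
  simp [hitGen, Polynomial.map_sum, Polynomial.map_prod, qfact, qint, qRook]

end HitPolynomial

section Insertion

variable {n : ℕ}

/-- The values of a permutation as a word indexed by `ℕ`, extended by zero. -/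
noncomputable def permWord (σ : Equiv.Perm (Fin n)) (i : ℕ) : ℕ :=
  if h : i < n then σ ⟨i, h⟩ else 0

/-- The descents of a permutation, as 1-based positions in `ℕ`. -/
noncomputable def descNat (σ : Equiv.Perm (Fin n)) : Finset ℕ :=
  (Finset.range n).filter fun d => 1 ≤ d ∧ permWord σ d < permWord σ (d - 1)

theorem mem_descNat {σ : Equiv.Perm (Fin n)} {d : ℕ} :
    d ∈ descNat σ ↔ d < n ∧ 1 ≤ d ∧ permWord σ d < permWord σ (d - 1) := by
  simp [descNat]

theorem descNat_eq_image (σ : Equiv.Perm (Fin n)) :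
    descNat σ = (descSet σ).image fun i : Fin n => (i : ℕ) + 1 := by
  ext d
  simp only [mem_descNat, descSet, Finset.mem_image, Finset.mem_filter, Finset.mem_univ, true_and]
  constructor
  · rintro ⟨h1, h2, h3⟩
    obtain ⟨e, rfl⟩ : ∃ e, d = e + 1 := ⟨d - 1, by omega⟩
    refine ⟨⟨e, by omega⟩, ⟨h1, ?_⟩, rfl⟩
    simpa [permWord, h1, Nat.lt_of_succ_lt h1] using h3
  · rintro ⟨i, ⟨h, hlt⟩, rfl⟩
    refine ⟨h, by omega, ?_⟩
    simpa [permWord, h] using hlt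

theorem desStat_eq (σ : Equiv.Perm (Fin n)) : desStat σ = (descNat σ).card := by
  rw [descNat_eq_image,
    Finset.card_image_of_injective _ fun a b h => Fin.ext (Nat.succ_injective h), desStat]

theorem majStat_eq (σ : Equiv.Perm (Fin n)) : majStat σ = ∑ d ∈ descNat σ, d := by
  rw [descNat_eq_image,
    Finset.sum_image fun a _ b _ h => Fin.ext (Nat.succ_injective h), majStat]

/-- Insert a new largest letter at position `p` of a permutation. -/
noncomputable def insertTop (p : Fin (n + 1)) (σ : Equiv.Perm (Fin n)) : Equiv.Perm (Fin (n + 1)) :=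
  (finSuccEquiv' p).trans ((Equiv.optionCongr σ).trans (finSuccEquiv' (Fin.last n)).symm)

theorem insertTop_self (p : Fin (n + 1)) (σ : Equiv.Perm (Fin n)) :
    insertTop p σ p = Fin.last n := by
  simp [insertTop]

theorem insertTop_succAbove (p : Fin (n + 1)) (σ : Equiv.Perm (Fin n)) (i : Fin n) :
    insertTop p σ (p.succAbove i) = (σ i).castSucc := by
  simp [insertTop]

theorem insertTop_bijective :
    Function.Bijective fun x : Fin (n + 1) × Equiv.Perm (Fin n) => insertTop x.1 x.2 := by
  rw [Fintype.bijective_iff_injective_and_card]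
  constructor
  · rintro ⟨p, σ⟩ ⟨p', σ'⟩ h
    dsimp only at h
    have hp : p = p' := by
      apply (insertTop p σ).injective
      rw [insertTop_self, h, insertTop_self]
    subst hp
    refine Prod.ext rfl (Equiv.ext fun i => Fin.castSucc_injective _ ?_)
    rw [← insertTop_succAbove p, h, insertTop_succAbove]
  · simp [Fintype.card_perm, Nat.factorial_succ]

theorem permWord_lt (σ : Equiv.Perm (Fin n)) {i : ℕ} (hi : i < n) : permWord σ i < n := by
  rw [permWord, dif_pos hi]
  exact (σ _).2

theorem permWord_insertTop_self (p : Fin (n + 1)) (σ : Equiv.Perm (Fin n)) :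
    permWord (insertTop p σ) p = n := by
  rw [permWord, dif_pos p.2, Fin.eta, insertTop_self, Fin.val_last]

theorem permWord_insertTop_of_lt (p : Fin (n + 1)) (σ : Equiv.Perm (Fin n)) {i : ℕ}
    (hi : i < p) : permWord (insertTop p σ) i = permWord σ i := by
  have hn : i < n := by omega
  have h := insertTop_succAbove p σ ⟨i, hn⟩
  rw [Fin.succAbove_of_castSucc_lt _ _ (by simpa [Fin.lt_def] using hi)] at h
  rw [permWord, dif_pos (by omega), permWord, dif_pos hn]
  exact congrArg Fin.val h

theorem permWord_insertTop_of_le (p : Fin (n + 1)) (σ : Equiv.Perm (Fin n)) {i : ℕ}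
    (hi : p ≤ i) (hn : i < n) : permWord (insertTop p σ) (i + 1) = permWord σ i := by
  have h := insertTop_succAbove p σ ⟨i, hn⟩
  rw [Fin.succAbove_of_le_castSucc _ _ (by simpa [Fin.le_def] using hi)] at h
  rw [permWord, dif_pos (by omega), permWord, dif_pos hn]
  exact congrArg Fin.val h

theorem descNat_insertTop (p : Fin (n + 1)) (σ : Equiv.Perm (Fin n)) :
    descNat (insertTop p σ) =
      ((descNat σ).filter (fun d => d < (p : ℕ))) ∪
        (if (p : ℕ) < n then {(p : ℕ) + 1} else ∅) ∪
        ((descNat σ).filter (fun d => (p : ℕ) < d)).image (fun d => d + 1) := by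
  have hp := p.2
  ext d
  have hR : d ∈ (if (p : ℕ) < n then {(p : ℕ) + 1} else ∅ : Finset ℕ) ↔ p < n ∧ d = p + 1 := by
    split_ifs with h <;> simp [h]
  simp only [Finset.mem_union, hR, Finset.mem_image, Finset.mem_filter]
  rw [mem_descNat]
  rcases lt_trichotomy d p with h | h | h
  · rw [permWord_insertTop_of_lt p σ h, permWord_insertTop_of_lt p σ (by omega : d - 1 < p),
      mem_descNat]
    constructor
    · intro H
      exact Or.inl (Or.inl ⟨⟨by omega, H.2⟩, h⟩)
    · rintro ((H | H) | ⟨e, H, rfl⟩)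
      · exact ⟨by omega, H.1.2⟩
      · omega
      · omega
  · constructor
    · rintro ⟨h1, h2, h3⟩
      rw [permWord_insertTop_of_lt p σ (by omega : d - 1 < p), h, permWord_insertTop_self] at h3
      have := permWord_lt σ (by omega : (p : ℕ) - 1 < n)
      omega
    · rintro ((H | H) | ⟨e, H, rfl⟩) <;> omega
  · obtain ⟨e, rfl⟩ : ∃ e, d = e + 1 := ⟨d - 1, by omega⟩
    rw [Nat.add_sub_cancel]
    have h' : p ≤ e := by omega
    rcases h'.eq_or_lt with he | he
    · subst he
      constructor
      · rintro ⟨h1, -⟩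
        exact Or.inl (Or.inr ⟨by omega, rfl⟩)
      · rintro ((H | H) | ⟨e, H, he⟩)
        · omega
        · rw [permWord_insertTop_self, permWord_insertTop_of_le p σ le_rfl H.1]
          exact ⟨by omega, by omega, permWord_lt σ H.1⟩
        · omega
    · obtain ⟨f, rfl⟩ : ∃ f, e = f + 1 := ⟨e - 1, by omega⟩
      constructor
      · rintro ⟨h1, -, h3⟩
        rw [permWord_insertTop_of_le p σ (by omega) (by omega),
          permWord_insertTop_of_le p σ (by omega) (by omega)] at h3
        exact Or.inr ⟨f + 1, ⟨mem_descNat.2 ⟨by omega, by omega, h3⟩, he⟩, rfl⟩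
      · rintro ((H | H) | ⟨e, ⟨H, -⟩, he'⟩)
        · omega
        · omega
        · obtain rfl := Nat.succ_injective he'
          rw [mem_descNat] at H
          rw [permWord_insertTop_of_le p σ (by omega) (by omega),
            permWord_insertTop_of_le p σ (by omega) (by omega)]
          exact ⟨by omega, by omega, H.2.2⟩

theorem card_descNat_insertTop (p : Fin (n + 1)) (σ : Equiv.Perm (Fin n)) :
    (descNat (insertTop p σ)).card =
      ((descNat σ).filter (fun d => d < (p : ℕ))).card + (if (p : ℕ) < n then 1 else 0) +
        ((descNat σ).filter (fun d => (p : ℕ) < d)).card := by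
  rw [descNat_insertTop, Finset.card_union_of_disjoint, Finset.card_union_of_disjoint,
    Finset.card_image_of_injective _ Nat.succ_injective]
  · split_ifs <;> simp
  · split_ifs <;> simp
  · rw [Finset.disjoint_right]
    split_ifs <;> simp <;> omega

theorem sum_descNat_insertTop (p : Fin (n + 1)) (σ : Equiv.Perm (Fin n)) :
    ∑ d ∈ descNat (insertTop p σ), d =
      ∑ d ∈ (descNat σ).filter (fun d => d < (p : ℕ)), d + (if (p : ℕ) < n then (p : ℕ) + 1 else 0) +
        (∑ d ∈ (descNat σ).filter (fun d => (p : ℕ) < d), d +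
          ((descNat σ).filter (fun d => (p : ℕ) < d)).card) := by
  rw [descNat_insertTop, Finset.sum_union, Finset.sum_union,
    Finset.sum_image fun a _ b _ h => Nat.add_right_cancel h, Finset.sum_add_distrib,
    Finset.card_eq_sum_ones]
  · split_ifs <;> simp
  · split_ifs <;> simp
  · rw [Finset.disjoint_right]
    split_ifs <;> simp <;> omega

theorem sum_eq_sum_lt_add_sum_gt (D : Finset ℕ) (g : ℕ → ℕ) (p : ℕ) :
    ∑ d ∈ D, g d = ∑ d ∈ D.filter (fun d => d < p), g d + (if p ∈ D then g p else 0) +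
      ∑ d ∈ D.filter (fun d => p < d), g d := by
  rw [← Finset.sum_ite_eq D p g, Finset.sum_filter, Finset.sum_filter,
    ← Finset.sum_add_distrib, ← Finset.sum_add_distrib]
  refine Finset.sum_congr rfl fun d _ => ?_
  rcases lt_trichotomy d p with h | h | h
  · simp [h, h.ne', h.not_gt]
  · simp [h]
  · simp [h, h.ne, h.not_gt]

theorem card_eq_card_lt_add_card_gt (D : Finset ℕ) (p : ℕ) :
    D.card = (D.filter (fun d => d < p)).card + (if p ∈ D then 1 else 0) +
      (D.filter (fun d => p < d)).card := by
  simpa only [Finset.card_eq_sum_ones] using sum_eq_sum_lt_add_sum_gt D (fun _ => 1) p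

theorem descNat_subset (σ : Equiv.Perm (Fin n)) : descNat σ ⊆ Finset.range n :=
  Finset.filter_subset _ _

variable {R : Type*} [CommRing R]

theorem sum_insertTop (q : R) (f : ℕ → R) (σ : Equiv.Perm (Fin n)) :
    ∑ p : Fin (n + 1), f (desStat (insertTop p σ)) * q ^ majStat (insertTop p σ) =
      q ^ majStat σ * (f (desStat σ) * qint q (desStat σ + 1) +
        f (desStat σ + 1) * (q ^ (desStat σ + 1) * qint q (n - desStat σ))) := by
  simp only [desStat_eq, majStat_eq, card_descNat_insertTop, sum_descNat_insertTop]
  have hD := descNat_subset σ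
  generalize descNat σ = D at hD
  rw [Fin.sum_univ_eq_sum_range (fun p => f ((D.filter (fun d => d < p)).card +
    (if p < n then 1 else 0) + (D.filter (fun d => p < d)).card) *
      q ^ (∑ d ∈ D.filter (fun d => d < p), d + (if p < n then p + 1 else 0) +
        (∑ d ∈ D.filter (fun d => p < d), d + (D.filter (fun d => p < d)).card))),
    Finset.sum_range_succ, ← Finset.sum_sdiff hD]
  have hlast1 : D.filter (fun d => d < n) = D :=
    Finset.filter_true_of_mem fun d hd => Finset.mem_range.1 (hD hd)
  have hlast2 : D.filter (fun d => n < d) = ∅ :=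
    Finset.filter_false_of_mem fun d hd => (Finset.mem_range.1 (hD hd)).not_gt
  simp only [hlast1, hlast2, lt_irrefl, if_false, Finset.card_empty, Finset.sum_empty, add_zero]
  have hin : ∑ p ∈ D, f ((D.filter (fun d => d < p)).card +
      (if p < n then 1 else 0) + (D.filter (fun d => p < d)).card) *
      q ^ (∑ d ∈ D.filter (fun d => d < p), d + (if p < n then p + 1 else 0) +
        (∑ d ∈ D.filter (fun d => p < d), d + (D.filter (fun d => p < d)).card)) =
      q ^ (∑ d ∈ D, d) * f D.card * (q * qint q D.card) := by
    rw [← sum_pow_card_gt q D, Finset.mul_sum, Finset.mul_sum]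
    refine Finset.sum_congr rfl fun p hp => ?_
    have h1 := sum_eq_sum_lt_add_sum_gt D id p
    have h2 := card_eq_card_lt_add_card_gt D p
    simp only [if_pos hp, id] at h1 h2
    rw [if_pos (Finset.mem_range.1 (hD hp)), if_pos (Finset.mem_range.1 (hD hp)), ← h2,
      ← pow_succ', mul_right_comm, ← pow_add, mul_comm]
    congr 2
    omega
  have hout : ∑ p ∈ Finset.range n \ D, f ((D.filter (fun d => d < p)).card +
      (if p < n then 1 else 0) + (D.filter (fun d => p < d)).card) *
      q ^ (∑ d ∈ D.filter (fun d => d < p), d + (if p < n then p + 1 else 0) +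
        (∑ d ∈ D.filter (fun d => p < d), d + (D.filter (fun d => p < d)).card)) =
      q ^ (∑ d ∈ D, d) * f (D.card + 1) * (q ^ (D.card + 1) * qint q (n - D.card)) := by
    have hcard : n - D.card = (Finset.range n \ D).card := by
      rw [Finset.card_sdiff_of_subset hD, Finset.card_range]
    rw [hcard, ← sum_pow_card_lt q (Finset.range n \ D), Finset.mul_sum, Finset.mul_sum]
    refine Finset.sum_congr rfl fun p hp => ?_
    obtain ⟨hpn, hpD⟩ := Finset.mem_sdiff.1 hp
    rw [Finset.mem_range] at hpn
    have h1 := sum_eq_sum_lt_add_sum_gt D id p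
    have h2 := card_eq_card_lt_add_card_gt D p
    simp only [if_neg hpD, id] at h1 h2
    have h3 : p = (D.filter (fun d => d < p)).card +
        ((Finset.range n \ D).filter (fun d => d < p)).card := by
      rw [← Finset.card_union_of_disjoint, ← Finset.filter_union,
        Finset.union_sdiff_of_subset hD]
      · have : (Finset.range n).filter (fun d => d < p) = Finset.range p := by
          ext d
          simp only [Finset.mem_filter, Finset.mem_range]
          omega
        rw [this, Finset.card_range]
      · exact Finset.disjoint_filter_filter Finset.disjoint_sdiff
    rw [if_pos hpn, if_pos hpn, ← pow_add, mul_right_comm, ← pow_add, mul_comm]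
    congr 2 <;> omega
  rw [hin, hout, qint_succ']
  ring

/-- The generating function of the major index over permutations with `k` descents. -/
noncomputable def eulerMahonian (q : R) (n k : ℕ) : R :=
  ∑ σ : Equiv.Perm (Fin n), if desStat σ = k then q ^ majStat σ else 0

theorem map_eulerMahonian {S : Type*} [CommRing S] (φ : R →+* S) (q : R) (n k : ℕ) :
    φ (eulerMahonian q n k) = eulerMahonian (φ q) n k := by
  simp only [eulerMahonian, map_sum, apply_ite φ, map_pow, map_zero]

theorem eulerMahonian_zero (q : R) (k : ℕ) :
    eulerMahonian q 0 k = if k = 0 then 1 else 0 := by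
  have h (σ : Equiv.Perm (Fin 0)) : descSet σ = ∅ := Subsingleton.elim _ _
  simp [eulerMahonian, desStat, majStat, h, eq_comm]

theorem desStat_le (σ : Equiv.Perm (Fin n)) : desStat σ ≤ n := by
  simpa [desStat_eq] using Finset.card_le_card (descNat_subset σ)

theorem eulerMahonian_succ (q : R) (n k : ℕ) :
    (q - 1) * eulerMahonian q (n + 1) k =
      ∑ σ : Equiv.Perm (Fin n), q ^ majStat σ *
        ((if desStat σ = k then 1 else 0) * (q ^ (desStat σ + 1) - 1) +
          (if desStat σ + 1 = k then 1 else 0) * (q ^ (n + 1) - q ^ (desStat σ + 1))) := by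
  have h : eulerMahonian q (n + 1) k = ∑ σ : Equiv.Perm (Fin n), ∑ p : Fin (n + 1),
      (if desStat (insertTop p σ) = k then 1 else 0) * q ^ majStat (insertTop p σ) := by
    rw [← Fintype.sum_prod_type_right', eulerMahonian, ← insertTop_bijective.sum_comp]
    simp only [ite_mul, one_mul, zero_mul]
  rw [h, Finset.mul_sum]
  refine Finset.sum_congr rfl fun σ _ => ?_
  rw [sum_insertTop q (fun d => if d = k then 1 else 0)]
  have hn : q ^ (n + 1) = q ^ (desStat σ + 1) * q ^ (n - desStat σ) := by
    rw [← pow_add]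
    congr 1
    have := desStat_le σ
    omega
  rw [hn, ← sub_one_mul_qint q (desStat σ + 1)]
  linear_combination q ^ majStat σ * (if desStat σ + 1 = k then 1 else 0) * q ^ (desStat σ + 1) *
    sub_one_mul_qint q (n - desStat σ)

theorem eulerMahonian_succ_zero (q : R) (n : ℕ) :
    (q - 1) * eulerMahonian q (n + 1) 0 = (q - 1) * eulerMahonian q n 0 := by
  rw [eulerMahonian_succ, eulerMahonian, Finset.mul_sum]
  refine Finset.sum_congr rfl fun σ _ => ?_
  by_cases h : desStat σ = 0 <;> simp [h, mul_comm]

theorem eulerMahonian_succ_succ (q : R) (n k : ℕ) :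
    (q - 1) * eulerMahonian q (n + 1) (k + 1) =
      (q ^ (k + 2) - 1) * eulerMahonian q n (k + 1) +
        (q ^ (n + 1) - q ^ (k + 1)) * eulerMahonian q n k := by
  rw [eulerMahonian_succ, eulerMahonian, eulerMahonian, Finset.mul_sum, Finset.mul_sum,
    ← Finset.sum_add_distrib]
  refine Finset.sum_congr rfl fun σ _ => ?_
  by_cases h : desStat σ = k
  · simp [h, mul_comm]
  · by_cases h' : desStat σ = k + 1 <;> simp [h, h', mul_comm]

end Insertion

theorem eulerMahonian_eq_qHit_of_ne_one {K : Type*} [Field K] {q : K} (hq : q ≠ 0) (hq1 : q ≠ 1)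
    (n k : ℕ) :
    q ^ n.choose 2 * eulerMahonian q n k = q ^ (n * k) * qHit q n (fun i => (i : ℕ)) k := by
  have hq1' : q - 1 ≠ 0 := sub_ne_zero.2 hq1
  induction n generalizing k with
  | zero => rw [eulerMahonian_zero, qHit_zero]; simp
  | succ n ih =>
    have hc : (n + 1).choose 2 = n + n.choose 2 := by
      rw [Nat.choose_succ_succ' n 1, Nat.choose_one_right]
    refine mul_left_cancel₀ hq1' ?_
    rw [hc, pow_add, mul_left_comm, mul_left_comm (q - 1)]
    cases k with
    | zero =>
      have h := ih 0
      rw [eulerMahonian_succ_zero, qHit_succ_zero hq]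
      rw [Nat.mul_zero, pow_zero, one_mul] at h ⊢
      linear_combination q ^ n * (q - 1) * h
    | succ k =>
      rw [eulerMahonian_succ_succ, qHit_succ_succ hq]
      have e0 : q ^ k * q⁻¹ ^ k = 1 := by rw [← mul_pow, mul_inv_cancel₀ hq, one_pow]
      have e1 : q ^ (k + 1) * q⁻¹ ^ (k + 1) = 1 := by
        rw [← mul_pow, mul_inv_cancel₀ hq, one_pow]
      have h0 := ih k
      have h1 := ih (k + 1)
      generalize qHit q n (fun i => (i : ℕ)) k = t0 at *
      generalize qHit q n (fun i => (i : ℕ)) (k + 1) = t1 at *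
      rw [show (n + 1) * (k + 1) = n * k + n + k + 1 by ring]
      rw [show n * (k + 1) = n * k + n by ring] at h1
      simp only [pow_add, pow_one] at *
      linear_combination q ^ n * (q ^ k * q ^ 2 - 1) * h1 +
        q ^ n * (q ^ n * q - q ^ k * q) * h0 +
        q ^ (n * k) * q ^ n * q ^ n * t1 * e1 - q ^ (n * k) * q ^ n * q ^ n * q * t0 * e0

theorem eulerMahonian_eq_qHit {K : Type*} [Field K] [Infinite K] (q : K) (n k : ℕ) :
    q ^ n.choose 2 * eulerMahonian q n k = q ^ (n * k) * qHit q n (fun i => (i : ℕ)) k := by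
  have eval_lhs (x : K) : Polynomial.eval x
      (Polynomial.X ^ n.choose 2 * eulerMahonian Polynomial.X n k) =
        x ^ n.choose 2 * eulerMahonian x n k := by
    rw [← Polynomial.coe_evalRingHom, map_mul, map_pow, map_eulerMahonian, Polynomial.coe_evalRingHom,
      Polynomial.eval_X]
  have eval_rhs (x : K) : Polynomial.eval x
      (Polynomial.X ^ (n * k) * qHit Polynomial.X n (fun i => (i : ℕ)) k) =
        x ^ (n * k) * qHit x n (fun i => (i : ℕ)) k := by
    rw [← Polynomial.coe_evalRingHom, map_mul, map_pow, map_qHit, Polynomial.coe_evalRingHom,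
      Polynomial.eval_X]
  rw [← eval_lhs, ← eval_rhs]
  congr 1
  refine Polynomial.eq_of_infinite_eval_eq _ _
    (((Set.toFinite {(0 : K), 1}).infinite_compl).mono fun x hx => ?_)
  simp only [Set.mem_compl_iff, Set.mem_insert_iff, Set.mem_singleton_iff, not_or] at hx
  exact (eval_lhs x).trans ((eulerMahonian_eq_qHit_of_ne_one hx.1 hx.2 n k).trans (eval_rhs x).symm)

theorem statement10 (q : ℚ) (hq : q ≠ 0) (n : ℕ) (hn : 1 ≤ n) (k : ℕ) (hk : k ≤ n - 1) :
    ∑ σ ∈ Finset.univ.filter (fun σ : Equiv.Perm (Fin n) => desStat σ = k),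
        q ^ majStat σ =
      q ^ ((n : ℤ) * k - n.choose 2) * qHit q n (fun j => (j : ℕ)) k := by
  have h := eulerMahonian_eq_qHit q n k
  rw [Finset.sum_filter, zpow_sub₀ hq, zpow_natCast, div_mul_eq_mul_div,
    eq_div_iff (pow_ne_zero _ hq), ← Nat.cast_mul, zpow_natCast, mul_comm, ← h, eulerMahonian]
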